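/- arXiv:2203.16642 — 4 statements merged into one kernel-verified Lean document; each statement's English description precedes it below -/
import Mathlib

section
/- Let N, M ∈ ℕ with N ≥ 1, let S_1, …, S_M ⊆ {1,…,N}, and for each i let c^i ∈ ℝ^N be the indicator vector of S_i (c^i_j = 1 if j ∈ S_i, else 0). Let X = {x ∈ ℝ^N : x ≥ 0, Σ_{j=1}^N x_j = 1} be the standard simplex. Then for any K with 1 ≤ K ≤ M, there exists a nonempty index set I ⊆ {1,…,M} with |I| ≤ K such that inf_{x∈X} max_{i∈I} (c^i)^⊤ x > 0 if and only if there exists I ⊆ {1,…,M} with |I| ≤ K such that ⋃_{i∈I} S_i = {1,…,N} (i.e., a set cover of cardinality at most K exists). -/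
/-- A set containing `j` has mass at least `x j` under a nonnegative weight `x`. -/
lemma le_sum_indicator_mul {N : ℕ} (T : Finset (Fin N)) {x : Fin N → ℝ} (hx : ∀ j, 0 ≤ x j)
    {j : Fin N} (hj : j ∈ T) : x j ≤ ∑ k, (if k ∈ T then (1 : ℝ) else 0) * x k := by
  simpa [hj] using Finset.single_le_sum (f := fun k => (if k ∈ T then (1 : ℝ) else 0) * x k)
    (fun k _ => mul_nonneg (by split_ifs <;> norm_num) (hx k)) (Finset.mem_univ j)

/-- Some coordinate of a point of the standard simplex is at least `1 / N`. -/
lemma exists_inv_le_of_sum_eq_one {N : ℕ} (hN : 1 ≤ N) {x : Fin N → ℝ} (hx : ∑ j, x j = 1) :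
    ∃ j, (N : ℝ)⁻¹ ≤ x j := by
  have hN' : (N : ℝ) ≠ 0 := by positivity
  have : Nonempty (Fin N) := ⟨⟨0, hN⟩⟩
  obtain ⟨j, -, hj⟩ := Finset.exists_le_of_sum_le (s := Finset.univ)
    (f := fun _ : Fin N => (N : ℝ)⁻¹) (g := x) Finset.univ_nonempty (by simp [hx, hN'])
  exact ⟨j, hj⟩

/-- Set Cover reduction correctness: there exists a nonempty index set `I` of size at most `K`
whose min-max value over the simplex is strictly positive iff a set cover of size at most `K`
exists. -/
theorem stmt_0 (N M : ℕ) (hN : 1 ≤ N) (S : Fin M → Finset (Fin N)) (K : ℕ)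
    (hK1 : 1 ≤ K) (hKM : K ≤ M) :
    (∃ I : Finset (Fin M), ∃ hI : I.Nonempty, I.card ≤ K ∧
      0 < sInf {v : ℝ | ∃ x : Fin N → ℝ, (∀ j, 0 ≤ x j) ∧ (∑ j, x j) = 1 ∧
        v = I.sup' hI (fun i => ∑ j, (if j ∈ S i then (1:ℝ) else 0) * x j)}) ↔
    (∃ I : Finset (Fin M), I.card ≤ K ∧ ∀ j : Fin N, ∃ i ∈ I, j ∈ S i) := by
  constructor
  · rintro ⟨I, hI, hcard, hpos⟩
    refine ⟨I, hcard, fun j => ?_⟩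
    by_contra! hj
    refine hpos.not_ge (csInf_le ⟨0, ?_⟩ ⟨Pi.single j 1, fun k => ?_, by simp, ?_⟩)
    · rintro v ⟨x, hx, -, rfl⟩
      obtain ⟨i, hi⟩ := hI
      exact Finset.le_sup'_of_le _ hi
        (Finset.sum_nonneg fun k _ => mul_nonneg (by split_ifs <;> norm_num) (hx k))
    · by_cases h : k = j
      · subst h; simp
      · simp [h]
    · refine (Finset.sup'_eq_of_forall hI _ fun i hi => ?_).symm
      simp [Pi.single_apply, hj i hi]
  · rintro ⟨I, hcard, hcov⟩
    have hI : I.Nonempty := let ⟨i, hi, _⟩ := hcov ⟨0, hN⟩; ⟨i, hi⟩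
    refine ⟨I, hI, hcard, lt_of_lt_of_le (b := (N : ℝ)⁻¹) (by positivity) (le_csInf ?_ ?_)⟩
    · refine ⟨_, Pi.single ⟨0, hN⟩ 1, fun k => ?_, by simp, rfl⟩
      by_cases h : k = ⟨0, hN⟩
      · subst h; simp
      · simp [h]
    · rintro v ⟨x, hx, hsum, rfl⟩
      obtain ⟨j, hj⟩ := exists_inv_le_of_sum_eq_one hN hsum
      obtain ⟨i, hi, hji⟩ := hcov j
      exact Finset.le_sup'_of_le _ hi (hj.trans (le_sum_indicator_mul (S i) hx hji))
end

section
/- Let X ⊆ {0,1}^n be finite and nonempty, let c^1, …, c^m ∈ ℝ^n, and let 1 ≤ k ≤ m. Then the value max over nonempty I ⊆ {1,…,m} with |I| ≤ k of min_{x∈X} max_{i∈I} (c^i)^⊤ x equals the maximum of τ ∈ ℝ over all τ ∈ ℝ, u ∈ {0,1}^m, and families (z^x)_{x∈X} with z^x ∈ {0,1}^m satisfying: τ ≤ Σ_{i=1}^m z^x_i (c^i)^⊤ x for all x ∈ X; z^x_i ≤ u_i for all i ∈ {1,…,m} and x ∈ X; Σ_{i=1}^m z^x_i = 1 for all x ∈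 X; and Σ_{i=1}^m u_i ≤ k. -/
/-- A maximum over a nonempty finite set of indices is attained by a binary selection vector
supported on that set. -/
lemma exists_binary_selection {ι : Type*} [Fintype ι] [DecidableEq ι] (I : Finset ι)
    (hI : I.Nonempty) (a : ι → ℝ) :
    ∃ z : ι → ℝ, (∀ i, z i = 0 ∨ z i = 1) ∧ I.sup' hI a = ∑ i, z i * a i ∧
      (∀ i, z i ≤ if i ∈ I then 1 else 0) ∧ ∑ i, z i = 1 := by
  obtain ⟨i₀, hi₀, h⟩ := I.exists_mem_eq_sup' hI a
  refine ⟨fun i => if i = i₀ then 1 else 0, fun i => ?_, by simp [h], fun i => ?_, by simp⟩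
  · by_cases hi : i = i₀ <;> simp [hi]
  · by_cases hi : i = i₀
    · simp [hi, hi₀]
    · simp only [hi, if_false]
      split_ifs <;> norm_num

/-- A convex combination with weights supported in `I` is at most the maximum over `I`. -/
lemma sum_mul_le_sup' {ι : Type*} [Fintype ι] (I : Finset ι) (hI : I.Nonempty) (a z : ι → ℝ)
    (hz : ∀ i, 0 ≤ z i) (hzI : ∀ i ∉ I, z i = 0) (hsum : ∑ i, z i = 1) :
    ∑ i, z i * a i ≤ I.sup' hI a := by
  calc ∑ i, z i * a i ≤ ∑ i, z i * I.sup' hI a := by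
        refine Finset.sum_le_sum fun i _ => ?_
        by_cases hi : i ∈ I
        · exact mul_le_mul_of_nonneg_left (Finset.le_sup' a hi) (hz i)
        · simp [hzI i hi]
    _ = I.sup' hI a := by rw [← Finset.sum_mul, hsum, one_mul]

/-- Binary linear reformulation of (RSRP-RO): the optimal value of the Relevant Scenario
Recognition Problem equals the maximum of `τ` in the binary program. -/
theorem stmt_3 (n m k : ℕ) (hk1 : 1 ≤ k) (hkm : k ≤ m)
    (X : Finset (Fin n → ℝ)) (hX : X.Nonempty)
    (hX01 : ∀ x ∈ X, ∀ j, x j = 0 ∨ x j = 1)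
    (c : Fin m → Fin n → ℝ) :
    ∃ v : ℝ,
      IsGreatest {w : ℝ | ∃ I : Finset (Fin m), ∃ hI : I.Nonempty, I.card ≤ k ∧
          w = X.inf' hX (fun x => I.sup' hI (fun i => ∑ j, c i j * x j))} v ∧
      IsGreatest {τ : ℝ | ∃ u : Fin m → ℝ, ∃ z : (Fin n → ℝ) → (Fin m → ℝ),
          (∀ i, u i = 0 ∨ u i = 1) ∧
          (∀ x ∈ X, ∀ i, z x i = 0 ∨ z x i = 1) ∧
          (∀ x ∈ X, τ ≤ ∑ i, z x i * ∑ j, c i j * x j) ∧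
          (∀ x ∈ X, ∀ i, z x i ≤ u i) ∧
          (∀ x ∈ X, (∑ i, z x i) = 1) ∧
          (∑ i, u i) ≤ (k : ℝ)} v := by
  have hfin : {w : ℝ | ∃ I : Finset (Fin m), ∃ hI : I.Nonempty, I.card ≤ k ∧
      w = X.inf' hX (fun x => I.sup' hI (fun i => ∑ j, c i j * x j))}.Finite := by
    refine (Set.finite_range fun I : {I : Finset (Fin m) // I.Nonempty} =>
      X.inf' hX (fun x => I.1.sup' I.2 (fun i => ∑ j, c i j * x j))).subset ?_
    rintro w ⟨I, hI, -, rfl⟩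
    exact ⟨⟨I, hI⟩, rfl⟩
  obtain ⟨v, hv, hmax⟩ := Set.exists_max_image _ id hfin
    ⟨_, {⟨0, by omega⟩}, Finset.singleton_nonempty _, by simpa using hk1, rfl⟩
  refine ⟨v, ⟨hv, fun w hw => hmax w hw⟩, ?_, ?_⟩
  · obtain ⟨I, hI, hcard, rfl⟩ := hv
    choose z hz01 hzval hzu hzsum using fun x : Fin n → ℝ =>
      exists_binary_selection I hI (fun i => ∑ j, c i j * x j)
    refine ⟨fun i => if i ∈ I then 1 else 0, z, fun i => ?_, fun x _ => hz01 x,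
      fun x hx => ?_, fun x _ => hzu x, fun x _ => hzsum x, by simpa using hcard⟩
    · by_cases hi : i ∈ I <;> simp [hi]
    · exact (Finset.inf'_le _ hx).trans_eq (hzval x)
  · rintro τ ⟨u, z, hu, hz, hτ, hzu, hzsum, husum⟩
    have hz0 : ∀ x ∈ X, ∀ i, 0 ≤ z x i := fun x hx i => by
      rcases hz x hx i with h | h <;> simp [h]
    have hsupp : ∀ x ∈ X, ∀ i ∉ Finset.univ.filter (fun i => u i = 1), z x i = 0 := by
      intro x hx i hi
      have hui : u i = 0 := (hu i).resolve_right (by simpa using hi)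
      exact le_antisymm (hui ▸ hzu x hx i) (hz0 x hx i)
    have hI : (Finset.univ.filter (fun i => u i = 1)).Nonempty := by
      obtain ⟨x, hx⟩ := hX
      by_contra h
      rw [Finset.not_nonempty_iff_eq_empty] at h
      have hzero : ∑ i, z x i = 0 :=
        Finset.sum_eq_zero fun i _ => hsupp x hx i (by simp [h])
      exact zero_ne_one (hzero.symm.trans (hzsum x hx))
    have hcard : (Finset.univ.filter (fun i => u i = 1)).card ≤ k := by
      have hu_eq : ∑ i, u i = ((Finset.univ.filter (fun i => u i = 1)).card : ℝ) := by
        rw [← Finset.sum_boole]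
        exact Finset.sum_congr rfl fun i _ => by rcases hu i with h | h <;> simp [h]
      exact_mod_cast hu_eq ▸ husum
    refine le_trans ?_ (hmax _ ⟨_, hI, hcard, rfl⟩)
    exact Finset.le_inf' _ _ fun x hx => (hτ x hx).trans
      (sum_mul_le_sup' _ hI _ (z x) (hz0 x hx) (hsupp x hx) (hzsum x hx))
end

section
/- Let c ∈ ℝ^n, let X ⊆ {0,1}^n and Y ⊆ ℝ^q be finite and nonempty, let A ∈ ℝ^{p×n}, D ∈ ℝ^{p×q}, b ∈ ℝ^p, let d^1, …, d^m ∈ ℝ^q, and let 1 ≤ k ≤ m. Assume that for every x ∈ X and every i ∈ {1,…,m} the set {y ∈ Y : Ax + Dy ≤ b} is nonempty. Then the value max over nonempty I ⊆ {1,…,m} with |I| ≤ k of min { c^⊤x + max_{i∈I} (d^i)^⊤ y^i : x ∈ X, y^i ∈ Y and Ax + D y^i ≤ b for all i ∈ I } equals the maximum of τ ∈ ℝ over all τ ∈ ℝ, u ∈ {0,1}^m, and families (z^{x,y})_{(x,y)} indexed by pairs of x ∈ X and m-tuples y = (y^1,…,y^m) ∈ Y^m with Ax + D y^i ≤ b for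 all i ∈ {1,…,m}, with z^{x,y} ∈ {0,1}^m, satisfying: τ ≤ c^⊤ x + Σ_{i=1}^m z^{x,y}_i (d^i)^⊤ y^i for all such pairs (x,y); Σ_{i=1}^m z^{x,y}_i = 1 for all such pairs; z^{x,y}_i ≤ u_i for all i and all such pairs; and Σ_{i=1}^m u_i ≤ k. -/
section ScenarioRecognition

variable {α β ι : Type*} [Fintype ι]

/-- Nonnegative multipliers that sum to one and are supported in `I` average `f` to at most its
maximum over `I`. -/
theorem sum_mul_le_sup'_of_support_subset {I : Finset ι} (hI : I.Nonempty) {z f : ι → ℝ}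
    (hz0 : ∀ i, 0 ≤ z i) (hz1 : ∑ i, z i = 1) (hzI : ∀ i, z i ≠ 0 → i ∈ I) :
    ∑ i, z i * f i ≤ I.sup' hI f := by
  calc ∑ i, z i * f i ≤ ∑ i, z i * I.sup' hI f := by
        refine Finset.sum_le_sum fun i _ => ?_
        by_cases h : z i = 0
        · simp [h]
        · exact mul_le_mul_of_nonneg_left (Finset.le_sup' f (hzI i h)) (hz0 i)
    _ = I.sup' hI f := by rw [← Finset.sum_mul, hz1, one_mul]

/-- A level `τ` is feasible for the binary program iff some admissible set of scenarios `I`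
has all its master objective values at least `τ`. -/
theorem binaryProgram_feasible_iff (k : ℕ) (X : Finset α) (hX : X.Nonempty)
    (F : α → β → Prop) (hF : ∀ x ∈ X, ∃ y, F x y) (C : α → ℝ) (f : ι → β → ℝ) (τ : ℝ) :
    (∃ u : ι → ℝ, ∃ z : α → (ι → β) → (ι → ℝ),
      (∀ i, u i = 0 ∨ u i = 1) ∧
      (∀ x ∈ X, ∀ y : ι → β, (∀ i, F x (y i)) →
        ((∀ i, z x y i = 0 ∨ z x y i = 1) ∧
         (τ ≤ C x + ∑ i, z x y i * f i (y i)) ∧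
         ((∑ i, z x y i) = 1) ∧
         (∀ i, z x y i ≤ u i))) ∧
      (∑ i, u i) ≤ (k : ℝ)) ↔
    ∃ I : Finset ι, ∃ hI : I.Nonempty, I.card ≤ k ∧
      ∀ x ∈ X, ∀ y : ι → β, (∀ i ∈ I, F x (y i)) →
        τ ≤ C x + I.sup' hI (fun i => f i (y i)) := by
  classical
  constructor
  · rintro ⟨u, z, hu, hz, hk⟩
    have support_mem : ∀ x ∈ X, ∀ y : ι → β, (∀ i, F x (y i)) → ∀ i, z x y i ≠ 0 →
        i ∈ Finset.univ.filter (fun i => u i = 1) := by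
      intro x hx y hy i hi
      obtain ⟨h01, -, -, hle⟩ := hz x hx y hy
      have h1 := (h01 i).resolve_left hi
      have h2 := hle i
      rcases hu i with h | h
      · linarith
      · simp [h]
    have hI : (Finset.univ.filter (fun i => u i = 1)).Nonempty := by
      obtain ⟨x, hx⟩ := hX
      obtain ⟨y, hy⟩ := hF x hx
      obtain ⟨-, -, hsum, -⟩ := hz x hx (fun _ => y) (fun _ => hy)
      obtain ⟨i, -, hi⟩ := Finset.exists_ne_zero_of_sum_ne_zero (hsum.trans_ne one_ne_zero)
      exact ⟨i, support_mem x hx _ (fun _ => hy) i hi⟩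
    refine ⟨_, hI, ?_, ?_⟩
    · have hcard : ((Finset.univ.filter (fun i => u i = 1)).card : ℝ) = ∑ i, u i := by
        rw [← Finset.sum_boole]
        refine Finset.sum_congr rfl fun i _ => ?_
        rcases hu i with h | h <;> simp [h]
      exact_mod_cast hcard.le.trans hk
    · intro x hx y hy
      obtain ⟨y₀, hy₀⟩ := hF x hx
      set y' : ι → β := fun i => if u i = 1 then y i else y₀ with hy'
      have hFy' : ∀ i, F x (y' i) := by
        intro i
        by_cases h : u i = 1
        · simpa [hy', h] using hy i (by simp [h])
        · simpa [hy', h] using hy₀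
      obtain ⟨h01, hτ, hsum, -⟩ := hz x hx y' hFy'
      have hle := sum_mul_le_sup'_of_support_subset hI (f := fun i => f i (y' i))
        (fun i => by rcases h01 i with h | h <;> simp [h]) hsum (support_mem x hx y' hFy')
      have hsup : (Finset.univ.filter (fun i => u i = 1)).sup' hI (fun i => f i (y' i)) =
          (Finset.univ.filter (fun i => u i = 1)).sup' hI (fun i => f i (y i)) := by
        refine Finset.sup'_congr hI rfl fun i hi => ?_
        have h : u i = 1 := by simpa using hi
        simp [hy', h]
      linarith
  · rintro ⟨I, hI, hk, hτ⟩
    choose s hs hsup using fun y : ι → β =>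
      Finset.exists_mem_eq_sup' hI (fun i => f i (y i))
    refine ⟨fun i => if i ∈ I then 1 else 0, fun _ y i => if i = s y then 1 else 0,
      fun i => by by_cases h : i ∈ I <;> simp [h], ?_, by simpa using hk⟩
    intro x hx y hy
    refine ⟨fun i => by by_cases h : i = s y <;> simp [h], ?_, by simp, ?_⟩
    · have h := hτ x hx y fun i _ => hy i
      rw [hsup y] at h
      simpa using h
    · intro i
      by_cases h : i = s y
      · simp [h, hs y]
      · by_cases h' : i ∈ I <;> simp [h, h']

/-- The optimal value of the relevant scenario recognition problem and that of its binary
program are both attained and coincide. -/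
theorem exists_isGreatest_recognition_and_binaryProgram [Nonempty ι] (k : ℕ) (hk : 1 ≤ k)
    (X : Finset α) (hX : X.Nonempty) (Y : Finset β) (F : α → β → Prop)
    (hFY : ∀ x y, F x y → y ∈ Y) (hF : ∀ x ∈ X, ∃ y, F x y) (C : α → ℝ) (f : ι → β → ℝ) :
    ∃ v : ℝ,
      IsGreatest {w : ℝ | ∃ I : Finset ι, ∃ hI : I.Nonempty, I.card ≤ k ∧
          w = sInf {v' : ℝ | ∃ x ∈ X, ∃ y : ι → β, (∀ i ∈ I, F x (y i)) ∧
            v' = C x + I.sup' hI (fun i => f i (y i))}} v ∧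
      IsGreatest {τ : ℝ | ∃ u : ι → ℝ, ∃ z : α → (ι → β) → (ι → ℝ),
          (∀ i, u i = 0 ∨ u i = 1) ∧
          (∀ x ∈ X, ∀ y : ι → β, (∀ i, F x (y i)) →
            ((∀ i, z x y i = 0 ∨ z x y i = 1) ∧
             (τ ≤ C x + ∑ i, z x y i * f i (y i)) ∧
             ((∑ i, z x y i) = 1) ∧
             (∀ i, z x y i ≤ u i))) ∧
          (∑ i, u i) ≤ (k : ℝ)} v := by
  classical
  simp only [binaryProgram_feasible_iff k X hX F hF C f]
  let S : (I : Finset ι) → I.Nonempty → Set ℝ := fun I hI =>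
    {v' : ℝ | ∃ x ∈ X, ∃ y : ι → β, (∀ i ∈ I, F x (y i)) ∧
      v' = C x + I.sup' hI (fun i => f i (y i))}
  have hne : ∀ I hI, (S I hI).Nonempty := by
    intro I hI
    obtain ⟨x, hx⟩ := hX
    obtain ⟨y, hy⟩ := hF x hx
    exact ⟨_, x, hx, fun _ => y, fun _ _ => hy, rfl⟩
  have hbdd : ∀ I hI, BddBelow (S I hI) := by
    rintro I ⟨i, hi⟩
    obtain ⟨B, hB⟩ := ((X ×ˢ Y).image fun a => C a.1 + f i a.2).bddBelow
    refine ⟨B, ?_⟩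
    rintro _ ⟨x, hx, y, hy, rfl⟩
    have h₁ : B ≤ C x + f i (y i) := hB <| Finset.mem_coe.2 <| Finset.mem_image.2
      ⟨(x, y i), Finset.mem_product.2 ⟨hx, hFY _ _ (hy i hi)⟩, rfl⟩
    have h₂ := Finset.le_sup' (fun i => f i (y i)) hi
    exact h₁.trans (by gcongr)
  let W : Set ℝ := {w : ℝ | ∃ I : Finset ι, ∃ hI : I.Nonempty, I.card ≤ k ∧ w = sInf (S I hI)}
  have hWfin : W.Finite := by
    refine (Set.finite_range fun I : {I : Finset ι // I.Nonempty} => sInf (S I.1 I.2)).subset ?_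
    rintro _ ⟨I, hI, -, rfl⟩
    exact ⟨⟨I, hI⟩, rfl⟩
  have hWne : W.Nonempty := by
    obtain ⟨i⟩ := ‹Nonempty ι›
    exact ⟨_, {i}, Finset.singleton_nonempty i, by simpa using hk, rfl⟩
  obtain ⟨v, hvW, hv⟩ := Set.exists_max_image W id hWfin hWne
  refine ⟨v, ⟨hvW, hv⟩, ?_, ?_⟩
  · obtain ⟨I, hI, hIk, rfl⟩ := hvW
    exact ⟨I, hI, hIk, fun x hx y hy => csInf_le (hbdd I hI) ⟨x, hx, y, hy, rfl⟩⟩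
  · rintro τ ⟨I, hI, hIk, hτ⟩
    refine le_trans (le_csInf (hne I hI) ?_) (hv _ ⟨I, hI, hIk, rfl⟩)
    rintro _ ⟨x, hx, y, hy, rfl⟩
    exact hτ x hx y hy

end ScenarioRecognition

/-- Binary linear reformulation of (RSRP-2RO): the optimal value of the two-stage Relevant
Scenario Recognition Problem equals the maximum of `τ` in the binary program. -/
theorem stmt_5 (n q p m k : ℕ) (hk1 : 1 ≤ k) (hkm : k ≤ m)
    (c : Fin n → ℝ)
    (X : Finset (Fin n → ℝ)) (hX : X.Nonempty)
    (hX01 : ∀ x ∈ X, ∀ j, x j = 0 ∨ x j = 1)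
    (Y : Finset (Fin q → ℝ)) (hY : Y.Nonempty)
    (A : Matrix (Fin p) (Fin n) ℝ) (D : Matrix (Fin p) (Fin q) ℝ) (b : Fin p → ℝ)
    (d : Fin m → Fin q → ℝ)
    (hfeas : ∀ x ∈ X, ∀ _i : Fin m, ∃ y ∈ Y,
      ∀ l, (∑ j, A l j * x j) + (∑ j, D l j * y j) ≤ b l) :
    ∃ v : ℝ,
      IsGreatest {w : ℝ | ∃ I : Finset (Fin m), ∃ hI : I.Nonempty, I.card ≤ k ∧
          w = sInf {v' : ℝ | ∃ x ∈ X, ∃ y : Fin m → (Fin q → ℝ),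
            (∀ i ∈ I, y i ∈ Y ∧ ∀ l, (∑ j, A l j * x j) + (∑ j, D l j * y i j) ≤ b l) ∧
            v' = (∑ j, c j * x j) + I.sup' hI (fun i => ∑ j, d i j * y i j)}} v ∧
      IsGreatest {τ : ℝ | ∃ u : Fin m → ℝ,
          ∃ z : (Fin n → ℝ) → (Fin m → (Fin q → ℝ)) → (Fin m → ℝ),
          (∀ i, u i = 0 ∨ u i = 1) ∧
          (∀ x ∈ X, ∀ y : Fin m → (Fin q → ℝ),
            (∀ i, y i ∈ Y ∧ ∀ l, (∑ j, A l j * x j) + (∑ j, D l j * y i j) ≤ b l) →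
            ((∀ i, z x y i = 0 ∨ z x y i = 1) ∧
             (τ ≤ (∑ j, c j * x j) + ∑ i, z x y i * ∑ j, d i j * y i j) ∧
             ((∑ i, z x y i) = 1) ∧
             (∀ i, z x y i ≤ u i))) ∧
          (∑ i, u i) ≤ (k : ℝ)} v := by
  have hm : Nonempty (Fin m) := ⟨⟨0, by omega⟩⟩
  exact exists_isGreatest_recognition_and_binaryProgram k hk1 X hX Y
    (fun x y => y ∈ Y ∧ ∀ l, (∑ j, A l j * x j) + (∑ j, D l j * y j) ≤ b l)
    (fun _ _ h => h.1) (fun x hx => hfeas x hx hm.some)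
    (fun x => ∑ j, c j * x j) (fun i y => ∑ j, d i j * y j)
end

section
/- Let X ⊆ ℝ^n be finite and nonempty, let U ⊆ ℝ^n be finite, and let U' ⊆ U be nonempty. Suppose x* ∈ X satisfies max_{c∈U'} c^⊤ x* = min_{x∈X} max_{c∈U'} c^⊤ x (i.e., x* is optimal for the master problem over U'), and suppose max_{c∈U} c^⊤ x* ≤ max_{c∈U'} c^⊤ x*. Then x* is optimal for the full robust problem, i.e., max_{c∈U} c^⊤ x* = min_{x∈X} max_{c∈U} c^⊤ x, and moreover min_{x∈X} max_{c∈U'} c^⊤ x = min_{x∈X} max_{c∈U} c^⊤ x. -/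
/-- Enlarging the scenario set can only increase the min-max value. -/
theorem Finset.inf'_sup'_mono {α β γ : Type*} [Lattice γ] (f : α → β → γ) {X : Finset α}
    (hX : X.Nonempty) {S T : Finset β} (hS : S.Nonempty) (hST : S ⊆ T) :
    X.inf' hX (fun x => S.sup' hS (f x)) ≤ X.inf' hX (fun x => T.sup' (hS.mono hST) (f x)) :=
  Finset.inf'_mono_fun fun x _ => Finset.sup'_mono (f x) hST hS

/-- Termination criterion of the scenario generation algorithm: if `xstar` is optimal for the
master problem over `U'` and no scenario of `U` improves its objective value, then `xstar` is
optimal for the full robust problem and the two optimal values coincide. -/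
theorem stmt_8 (n : ℕ) (X U' U : Finset (Fin n → ℝ)) (hX : X.Nonempty)
    (hU' : U'.Nonempty) (hsub : U' ⊆ U)
    (xstar : Fin n → ℝ) (hxstar : xstar ∈ X)
    (hopt : U'.sup' hU' (fun c => ∑ j, c j * xstar j) =
      X.inf' hX (fun x => U'.sup' hU' (fun c => ∑ j, c j * x j)))
    (hterm : U.sup' (hU'.mono hsub) (fun c => ∑ j, c j * xstar j) ≤
      U'.sup' hU' (fun c => ∑ j, c j * xstar j)) :
    U.sup' (hU'.mono hsub) (fun c => ∑ j, c j * xstar j) =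
      X.inf' hX (fun x => U.sup' (hU'.mono hsub) (fun c => ∑ j, c j * x j)) ∧
    X.inf' hX (fun x => U'.sup' hU' (fun c => ∑ j, c j * x j)) =
      X.inf' hX (fun x => U.sup' (hU'.mono hsub) (fun c => ∑ j, c j * x j)) := by
  have hmono := Finset.inf'_sup'_mono (fun x c : Fin n → ℝ => ∑ j, c j * x j) hX hU' hsub
  have hle := Finset.inf'_le (fun x => U.sup' (hU'.mono hsub) (fun c => ∑ j, c j * x j)) hxstar
  have hge := hterm.trans hopt.le
  exact ⟨le_antisymm (hge.trans hmono) hle, le_antisymm hmono (hle.trans hge)⟩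
end
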